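/- Let μ, ν ∈ ℝ and let f : [0,∞) → ℝ be continuously differentiable with f and f' bounded and f(x) → 0 as x → ∞. If u is a solution of the Stroock–Williams problem with parameters μ, ν and initial data f, then for every t > 0 and x ≥ 0: u(t,x) = ∫₀^∞ f(y)·( G(t;x,y) + ∂_y H(t;x,y) ) dy + f(0)·H(t;x,0), where ∂_y H denotes the partial derivative of H(t;x,y) in y. -/

import Mathlib

open MeasureTheory Set Filter

/-- Standard normal density. -/
noncomputable def phi (x : ℝ) : ℝ := (1 / Real.sqrt (2 * Real.pi)) * Real.exp (-x ^ 2 / 2)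

/-- Standard normal tail function. -/
noncomputable def Psi (x : ℝ) : ℝ := ∫ y in Set.Ioi x, phi y

/-- The kernel `G(t;x,y)` with drift parameter `μ`. -/
noncomputable def Gker (μ t x y : ℝ) : ℝ :=
  (1 / Real.sqrt t) *
      (Real.exp (2 * μ * y) * phi ((x + y + μ * t) / Real.sqrt t) +
        phi ((x - y + μ * t) / Real.sqrt t)) -
    2 * μ * Real.exp (2 * μ * y) * Psi ((x + y + μ * t) / Real.sqrt t)

/-- The kernel `H(t;x,y)` with parameters `μ, ν`. -/
noncomputable def Hker (μ ν t x y : ℝ) : ℝ :=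
  if ν = μ then
    2 * Real.exp (2 * μ * y) *
      ((1 + μ * (x + y + μ * t)) * Psi ((x + y + μ * t) / Real.sqrt t) -
        μ * Real.sqrt t * phi ((x + y + μ * t) / Real.sqrt t))
  else
    Real.exp (2 * μ * y) / (ν - μ) *
      ((2 * ν - μ) * Real.exp (2 * (ν - μ) * (x + y + ν * t)) *
          Psi ((x + y + (2 * ν - μ) * t) / Real.sqrt t) -
        μ * Psi ((x + y + μ * t) / Real.sqrt t))

/-- The density `g(t;b,s)` of `(B_t^{-μ}, S_t^{-μ})`, vanishing off `{b ≤ s, 0 ≤ s}`. -/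
noncomputable def gker (μ t b s : ℝ) : ℝ :=
  if b ≤ s ∧ 0 ≤ s then
    Real.sqrt (2 / Real.pi) * t ^ (-(3 : ℝ) / 2) * (2 * s - b) *
      Real.exp (-(2 * s - b) ^ 2 / (2 * t) - μ * (b + μ * t / 2))
  else 0

/-- Spatial derivative (one-sided at `x = 0`). -/
noncomputable def ux (u : ℝ → ℝ → ℝ) (t x : ℝ) : ℝ :=
  derivWithin (fun z => u t z) (Set.Ici 0) x

/-- Second spatial derivative (one-sided at `x = 0`). -/
noncomputable def uxx (u : ℝ → ℝ → ℝ) (t x : ℝ) : ℝ :=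
  derivWithin (fun z => ux u t z) (Set.Ici 0) x

/-- Time derivative. -/
noncomputable def ut (u : ℝ → ℝ → ℝ) (t x : ℝ) : ℝ :=
  deriv (fun s => u s x) t

/-- `u` is a solution of the Stroock–Williams problem with parameters `μ, ν`
and initial data `f`. -/
def IsSWSolution (μ ν : ℝ) (f : ℝ → ℝ) (u : ℝ → ℝ → ℝ) : Prop :=
  ContDiffOn ℝ (⊤ : ℕ∞) (fun p : ℝ × ℝ => u p.1 p.2) (Set.Ioi 0 ×ˢ Set.Ici 0) ∧
  (∀ T > (0 : ℝ),
    ContinuousOn (fun p : ℝ × ℝ => u p.1 p.2) (Set.Icc 0 T ×ˢ Set.Ici 0) ∧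
    ContinuousOn (fun p : ℝ × ℝ => ux u p.1 p.2) (Set.Icc 0 T ×ˢ Set.Ici 0) ∧
    ∃ C : ℝ, ∀ p ∈ Set.Icc (0 : ℝ) T ×ˢ Set.Ici (0 : ℝ),
      |u p.1 p.2| ≤ C ∧ |ux u p.1 p.2| ≤ C) ∧
  (∀ t > (0 : ℝ), Filter.Tendsto (fun x => u t x) Filter.atTop (nhds 0)) ∧
  (∀ t > (0 : ℝ), ∀ x ≥ (0 : ℝ), ut u t x = μ * ux u t x + (1 / 2) * uxx u t x) ∧
  (∀ x ≥ (0 : ℝ), u 0 x = f x) ∧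
  (∀ t > (0 : ℝ), ut u t 0 = ν * ux u t 0)

/-- `f` is admissible initial data: `C¹` on `[0,∞)` with `f` and `f'` bounded
and `f(x) → 0` as `x → ∞`. -/
def IsInitialData (f : ℝ → ℝ) : Prop :=
  ContDiffOn ℝ 1 f (Set.Ici 0) ∧
  (∃ C : ℝ, ∀ x ∈ Set.Ici (0 : ℝ), |f x| ≤ C ∧ |derivWithin f (Set.Ici 0) x| ≤ C) ∧
  Filter.Tendsto f Filter.atTop (nhds 0)

open Real in
theorem phi_pos (x : ℝ) : 0 < phi x := by unfold phi; positivity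

theorem phi_eq_gaussianPDFReal : phi = ProbabilityTheory.gaussianPDFReal 0 1 := by
  ext x
  simp [phi, ProbabilityTheory.gaussianPDFReal]

theorem continuous_phi : Continuous phi := by unfold phi; fun_prop

theorem integrable_phi : Integrable phi := by
  rw [phi_eq_gaussianPDFReal]; exact ProbabilityTheory.integrable_gaussianPDFReal 0 1

theorem integral_phi : ∫ x, phi x = 1 := by
  rw [phi_eq_gaussianPDFReal]
  exact ProbabilityTheory.integral_gaussianPDFReal_eq_one 0 one_ne_zero

theorem phi_neg (x : ℝ) : phi (-x) = phi x := by simp [phi]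

theorem hasDerivAt_phi (x : ℝ) : HasDerivAt phi (-x * phi x) x := by
  unfold phi
  have h : HasDerivAt (fun x : ℝ => -x ^ 2 / 2) (-x) x := by
    have := ((hasDerivAt_pow 2 x).neg).div_const 2
    refine this.congr_deriv ?_
    norm_num
    ring
  refine (h.exp.const_mul (1 / Real.sqrt (2 * Real.pi))).congr_deriv ?_
  ring

theorem Psi_eq (x : ℝ) : Psi x = Psi 0 - ∫ y in (0 : ℝ)..x, phi y := by
  have h := intervalIntegral.integral_interval_add_Ioi (a := 0) (b := x)
    (integrable_phi.integrableOn) (integrable_phi.integrableOn)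
  unfold Psi
  linarith

theorem hasDerivAt_Psi (x : ℝ) : HasDerivAt Psi (-phi x) x := by
  have h := (intervalIntegral.integral_hasDerivAt_right (a := 0) (b := x)
    (integrable_phi.intervalIntegrable)
    (continuous_phi.stronglyMeasurableAtFilter _ _) continuous_phi.continuousAt).const_sub (Psi 0)
  rwa [← funext Psi_eq] at h

theorem continuous_Psi : Continuous Psi :=
  continuous_iff_continuousAt.2 fun x => (hasDerivAt_Psi x).continuousAt

theorem Psi_nonneg (x : ℝ) : 0 ≤ Psi x :=
  integral_nonneg fun y => (phi_pos y).le

theorem Psi_zero : Psi 0 = 1 / 2 := by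
  have h1 : (∫ x in Set.Iic 0, phi x) = Psi 0 := by
    have := integral_comp_neg_Iic 0 phi
    simpa [phi_neg, Psi] using this
  have h2 := intervalIntegral.integral_Iic_add_Ioi (f := phi) (b := 0)
    integrable_phi.integrableOn integrable_phi.integrableOn
  rw [h1, integral_phi] at h2
  unfold Psi at *
  linarith

theorem phi_le_exp (l z : ℝ) : phi z ≤ Real.exp (l ^ 2 / 2 - l * z) := by
  have h1 : 1 / Real.sqrt (2 * Real.pi) ≤ 1 := by
    rw [div_le_one (by positivity)]
    exact Real.one_le_sqrt.2 (by nlinarith [Real.pi_gt_three])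
  calc phi z ≤ 1 * Real.exp (-z ^ 2 / 2) := by unfold phi; gcongr
    _ ≤ _ := by
      rw [one_mul]; apply Real.exp_le_exp.2; nlinarith [sq_nonneg (z - l)]

/-- Chernoff bound for the normal tail. -/
theorem Psi_le_exp {l : ℝ} (hl : 0 ≤ l) (z : ℝ) : Psi z ≤ Real.exp (l ^ 2 / 2 - l * z) := by
  have key : ∀ y, Real.exp (l * y) * phi y = Real.exp (l ^ 2 / 2) * phi (y - l) := by
    intro y
    simp only [phi]
    rw [mul_left_comm, ← Real.exp_add, mul_left_comm, ← Real.exp_add]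
    ring_nf
  have hint : Integrable fun y => Real.exp (-l * z) * (Real.exp (l ^ 2 / 2) * phi (y - l)) :=
    ((integrable_phi.comp_sub_right l).const_mul _).const_mul _
  calc Psi z ≤ ∫ y in Set.Ioi z, Real.exp (-l * z) * (Real.exp (l ^ 2 / 2) * phi (y - l)) := by
        apply setIntegral_mono_on integrable_phi.integrableOn hint.integrableOn measurableSet_Ioi
        intro y hy
        rw [← key, ← mul_assoc, ← Real.exp_add]
        have : 1 ≤ Real.exp (-l * z + l * y) :=
          Real.one_le_exp (by nlinarith [mul_nonneg hl (sub_nonneg.2 (le_of_lt hy))])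
        nlinarith [phi_pos y]
    _ ≤ ∫ y, Real.exp (-l * z) * (Real.exp (l ^ 2 / 2) * phi (y - l)) :=
        setIntegral_le_integral hint (ae_of_all _ fun y => by
          have := phi_pos (y - l); positivity)
    _ = _ := by
        rw [integral_const_mul, integral_const_mul, integral_sub_right_eq_self, integral_phi,
          mul_one, ← Real.exp_add]
        ring_nf

theorem tendsto_Psi_atTop : Tendsto Psi atTop (nhds 0) := by
  refine squeeze_zero Psi_nonneg (fun z => Psi_le_exp zero_le_one z) ?_
  refine Real.tendsto_exp_atBot.comp ?_
  refine tendsto_atBot_add_const_left _ _ ?_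
  simpa using tendsto_neg_atTop_atBot (G := ℝ)

theorem hasDerivAt_div_sqrt (w c : ℝ) {t : ℝ} (ht : 0 < t) :
    HasDerivAt (fun t => (w + c * t) / Real.sqrt t) ((c - w / t) / (2 * Real.sqrt t)) t := by
  have h := (((hasDerivAt_id t).const_mul c).const_add w).div (Real.hasDerivAt_sqrt ht.ne')
    (Real.sqrt_pos.2 ht).ne'
  refine h.congr_deriv ?_
  have hs := Real.sq_sqrt ht.le
  have hs' := Real.sqrt_pos.2 ht
  simp only [id]
  rw [hs]
  set r := Real.sqrt t with hr
  rw [← hs]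
  field_simp
  ring

/-- Gaussian density in `y` with mean `c + μ t` and variance `t`. -/
noncomputable def gaussKer (μ c t y : ℝ) : ℝ :=
  1 / Real.sqrt t * phi ((y - c - μ * t) / Real.sqrt t)

/-- The Gaussian kernel reflected at the boundary. -/
noncomputable def reflKer (μ t x y : ℝ) : ℝ := Real.exp (-2 * μ * x) * gaussKer μ (-x) t y

/-- The exponentially weighted Gaussian tails from which `Hker` is built. -/
noncomputable def tailKer (μ κ t x y : ℝ) : ℝ :=
  Real.exp (2 * μ * y + 2 * (κ - μ) * (x + y + κ * t)) *
    Psi ((x + y + (2 * κ - μ) * t) / Real.sqrt t)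

theorem gaussKer_eq (μ t x y : ℝ) :
    gaussKer μ x t y = 1 / Real.sqrt t * phi ((x - y + μ * t) / Real.sqrt t) := by
  unfold gaussKer; rw [← phi_neg]; ring_nf

theorem exp_mul_phi (κ μ w : ℝ) {t : ℝ} (ht : 0 < t) :
    Real.exp (2 * (κ - μ) * (w + κ * t)) * phi ((w + (2 * κ - μ) * t) / Real.sqrt t) =
      phi ((w + μ * t) / Real.sqrt t) := by
  simp only [phi, div_pow, Real.sq_sqrt ht.le]
  rw [mul_left_comm, ← Real.exp_add]
  congr 2
  field_simp
  ring

theorem reflKer_eq (μ x y : ℝ) {t : ℝ} (ht : 0 < t) :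
    reflKer μ t x y =
      1 / Real.sqrt t * (Real.exp (2 * μ * y) * phi ((x + y + μ * t) / Real.sqrt t)) := by
  unfold reflKer gaussKer
  have h := exp_mul_phi 0 μ (x + y) ht
  rw [← h, mul_left_comm, ← mul_assoc (Real.exp (2 * μ * y)), ← Real.exp_add]
  ring_nf

theorem hasDerivAt_gaussKer_y (μ c y : ℝ) {t : ℝ} (ht : 0 < t) :
    HasDerivAt (gaussKer μ c t) (((c - y) / t + μ) * gaussKer μ c t y) y := by
  have h1 : HasDerivAt (fun y => (y - c - μ * t) / Real.sqrt t) (1 / Real.sqrt t) y :=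
    (((hasDerivAt_id y).sub_const c).sub_const _).div_const _
  have h := ((hasDerivAt_phi _).comp y h1).const_mul (1 / Real.sqrt t)
  refine h.congr_deriv ?_
  have hs := Real.sq_sqrt ht.le
  have hs' := Real.sqrt_pos.2 ht
  unfold gaussKer
  generalize phi ((y - c - μ * t) / Real.sqrt t) = p
  field_simp
  rw [hs]
  ring

theorem hasDerivAt_gaussKer_t (μ c y : ℝ) {t : ℝ} (ht : 0 < t) :
    HasDerivAt (fun t => gaussKer μ c t y)
      ((-1 / (2 * t) + (y - c) ^ 2 / (2 * t ^ 2) - μ ^ 2 / 2) * gaussKer μ c t y) t := by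
  have h1 : HasDerivAt (fun t => (y - c - μ * t) / Real.sqrt t)
      ((-μ - (y - c) / t) / (2 * Real.sqrt t)) t := by
    simpa only [neg_mul, ← sub_eq_add_neg] using hasDerivAt_div_sqrt (y - c) (-μ) ht
  have h2 := (Real.hasDerivAt_sqrt ht.ne').inv (Real.sqrt_pos.2 ht).ne'
  have h := h2.mul ((hasDerivAt_phi _).comp t h1)
  have : (fun t => gaussKer μ c t y) =
      (fun t => (Real.sqrt t)⁻¹) * (phi ∘ fun t => (y - c - μ * t) / Real.sqrt t) := by
    ext t; simp [gaussKer]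
  rw [this]
  refine h.congr_deriv ?_
  have hs := Real.sq_sqrt ht.le
  have hs' := Real.sqrt_pos.2 ht
  unfold gaussKer
  simp only [Function.comp, Pi.inv_apply]
  generalize phi ((y - c - μ * t) / Real.sqrt t) = p
  rw [hs]
  generalize Real.sqrt t = r at *
  subst hs
  field_simp
  ring

theorem hasDerivAt_reflKer_y (μ x y : ℝ) {t : ℝ} (ht : 0 < t) :
    HasDerivAt (reflKer μ t x) ((μ - (x + y) / t) * reflKer μ t x y) y := by
  refine ((hasDerivAt_gaussKer_y μ (-x) y ht).const_mul (Real.exp (-2 * μ * x))).congr_deriv ?_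
  unfold reflKer; ring

theorem hasDerivAt_reflKer_t (μ x y : ℝ) {t : ℝ} (ht : 0 < t) :
    HasDerivAt (fun t => reflKer μ t x y)
      ((-1 / (2 * t) + (x + y) ^ 2 / (2 * t ^ 2) - μ ^ 2 / 2) * reflKer μ t x y) t := by
  refine ((hasDerivAt_gaussKer_t μ (-x) y ht).const_mul (Real.exp (-2 * μ * x))).congr_deriv ?_
  unfold reflKer; ring

theorem exp_mul_phi_eq_reflKer (μ κ x y : ℝ) {t : ℝ} (ht : 0 < t) :
    Real.exp (2 * μ * y + 2 * (κ - μ) * (x + y + κ * t)) *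
      phi ((x + y + (2 * κ - μ) * t) / Real.sqrt t) = Real.sqrt t * reflKer μ t x y := by
  have hs' := Real.sqrt_pos.2 ht
  rw [reflKer_eq μ x y ht, Real.exp_add, mul_assoc, exp_mul_phi κ μ (x + y) ht]
  field_simp

theorem hasDerivAt_tailKer_y (μ κ x y : ℝ) {t : ℝ} (ht : 0 < t) :
    HasDerivAt (tailKer μ κ t x) (2 * κ * tailKer μ κ t x y - reflKer μ t x y) y := by
  have h1 : HasDerivAt (fun y => (x + y + (2 * κ - μ) * t) / Real.sqrt t) (1 / Real.sqrt t) y :=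
    (((hasDerivAt_id y).const_add x).add_const _).div_const _
  have h2 : HasDerivAt (fun y => 2 * μ * y + 2 * (κ - μ) * (x + y + κ * t)) (2 * κ) y := by
    refine (((hasDerivAt_id y).const_mul (2 * μ)).add ((((hasDerivAt_id y).const_add x).add_const
      (κ * t)).const_mul (2 * (κ - μ)))).congr_deriv ?_
    ring
  refine (h2.exp.mul ((hasDerivAt_Psi _).comp y h1)).congr_deriv ?_
  have h3 := exp_mul_phi_eq_reflKer μ κ x y ht
  have hs' := Real.sqrt_pos.2 ht
  simp only [Function.comp, tailKer]
  generalize phi ((x + y + (2 * κ - μ) * t) / Real.sqrt t) = p at *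
  generalize Psi ((x + y + (2 * κ - μ) * t) / Real.sqrt t) = q at *
  generalize Real.exp (2 * μ * y + 2 * (κ - μ) * (x + y + κ * t)) = e at *
  field_simp
  linear_combination -h3

theorem hasDerivAt_tailKer_t (μ κ x y : ℝ) {t : ℝ} (ht : 0 < t) :
    HasDerivAt (fun t => tailKer μ κ t x y) (2 * κ * (κ - μ) * tailKer μ κ t x y +
      ((x + y) / t - (2 * κ - μ)) / 2 * reflKer μ t x y) t := by
  have h2 : HasDerivAt (fun t => 2 * μ * y + 2 * (κ - μ) * (x + y + κ * t))
      (2 * κ * (κ - μ)) t := by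
    refine (((((hasDerivAt_id t).const_mul κ).const_add (x + y)).const_mul
      (2 * (κ - μ))).const_add (2 * μ * y)).congr_deriv ?_
    ring
  refine (h2.exp.mul ((hasDerivAt_Psi _).comp t (hasDerivAt_div_sqrt (x + y) (2 * κ - μ) ht))).congr_deriv
    ?_
  have h3 := exp_mul_phi_eq_reflKer μ κ x y ht
  have hs' := Real.sqrt_pos.2 ht
  simp only [Function.comp, tailKer]
  generalize phi ((x + y + (2 * κ - μ) * t) / Real.sqrt t) = p at *
  generalize Psi ((x + y + (2 * κ - μ) * t) / Real.sqrt t) = q at *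
  generalize Real.exp (2 * μ * y + 2 * (κ - μ) * (x + y + κ * t)) = e at *
  field_simp
  linear_combination -(2 * κ * t - t * μ - (x + y)) * h3

theorem Hker_eq_of_ne {μ ν : ℝ} (h : ν ≠ μ) (t x y : ℝ) :
    Hker μ ν t x y = ((2 * ν - μ) * tailKer μ ν t x y - μ * tailKer μ μ t x y) / (ν - μ) := by
  simp only [Hker, if_neg h, tailKer, Real.exp_add, sub_self, mul_zero, zero_mul, Real.exp_zero]
  ring_nf

theorem Hker_self (μ x y : ℝ) {t : ℝ} (ht : 0 < t) :
    Hker μ μ t x y = 2 * ((1 + μ * (x + y + μ * t)) * tailKer μ μ t x y -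
      μ * t * reflKer μ t x y) := by
  have hs := Real.sq_sqrt ht.le
  have hs' := Real.sqrt_pos.2 ht
  rw [reflKer_eq μ x y ht]
  simp only [Hker, if_true, tailKer, Real.exp_add, sub_self, mul_zero, zero_mul, Real.exp_zero]
  rw [show (2 * μ - μ) * t = μ * t by ring]
  generalize phi ((x + y + μ * t) / Real.sqrt t) = p at *
  generalize Psi ((x + y + μ * t) / Real.sqrt t) = q at *
  generalize Real.sqrt t = r at *
  subst hs
  field_simp

theorem hasDerivAt_Hker_y (μ ν x y : ℝ) {t : ℝ} (ht : 0 < t) :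
    HasDerivAt (Hker μ ν t x)
      (2 * ν * Hker μ ν t x y + 2 * μ * tailKer μ μ t x y - 2 * reflKer μ t x y) y := by
  have hE := hasDerivAt_tailKer_y μ μ x y ht
  by_cases h : ν = μ
  · subst h
    rw [show Hker ν ν t x = _ from funext fun y => Hker_self ν x y ht]
    have h1 : HasDerivAt (fun y => 1 + ν * (x + y + ν * t)) ν y := by
      refine (((((hasDerivAt_id y).const_add x).add_const (ν * t)).const_mul ν).const_add
        1).congr_deriv (by ring)
    refine (((h1.mul hE).sub ((hasDerivAt_reflKer_y ν x y ht).const_mul (ν * t))).const_mul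
      2).congr_deriv ?_
    field_simp
    ring
  · have h' : ν - μ ≠ 0 := sub_ne_zero.2 h
    rw [funext (Hker_eq_of_ne h t x)]
    refine ((((hasDerivAt_tailKer_y μ ν x y ht).const_mul (2 * ν - μ)).sub
      (hE.const_mul μ)).div_const (ν - μ)).congr_deriv ?_
    field_simp
    ring

theorem hasDerivAt_Hker_t (μ ν x y : ℝ) {t : ℝ} (ht : 0 < t) :
    HasDerivAt (fun t => Hker μ ν t x y)
      (2 * ν * (ν - μ) * Hker μ ν t x y + 2 * μ * ν * tailKer μ μ t x y +
        ((x + y) / t - 2 * ν) * reflKer μ t x y) t := by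
  have hE := hasDerivAt_tailKer_t μ μ x y ht
  by_cases h : ν = μ
  · subst h
    have h1 : HasDerivAt (fun t => 1 + ν * (x + y + ν * t)) (ν ^ 2) t := by
      refine (((((hasDerivAt_id t).const_mul ν).const_add (x + y)).const_mul ν).const_add
        1).congr_deriv (by ring)
    have h2 := (((h1.mul hE).sub (((hasDerivAt_id t).const_mul ν).mul
      (hasDerivAt_reflKer_t ν x y ht))).const_mul 2)
    refine (h2.congr_of_eventuallyEq ?_).congr_deriv ?_
    · filter_upwards [lt_mem_nhds ht] with s hs using Hker_self ν x y hs
    · simp only [id]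
      field_simp
      ring
  · have h' : ν - μ ≠ 0 := sub_ne_zero.2 h
    simp only [Hker_eq_of_ne h]
    refine ((((hasDerivAt_tailKer_t μ ν x y ht).const_mul (2 * ν - μ)).sub
      (hE.const_mul μ)).div_const (ν - μ)).congr_deriv ?_
    field_simp
    ring

/-- The kernel `G + ∂_y H`. -/
noncomputable def fullKer (μ ν t x y : ℝ) : ℝ :=
  gaussKer μ x t y - reflKer μ t x y + 2 * ν * Hker μ ν t x y

theorem Gker_add_deriv_Hker (μ ν x y : ℝ) {t : ℝ} (ht : 0 < t) :
    Gker μ t x y + deriv (fun z => Hker μ ν t x z) y = fullKer μ ν t x y := by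
  rw [(hasDerivAt_Hker_y μ ν x y ht).deriv, fullKer, Gker, reflKer_eq μ x y ht, gaussKer_eq]
  simp only [tailKer, sub_self, mul_zero, zero_mul, add_zero]
  ring_nf

noncomputable def fullKerDy (μ ν t x y : ℝ) : ℝ :=
  ((x - y) / t + μ) * gaussKer μ x t y - (μ - (x + y) / t) * reflKer μ t x y +
    2 * ν * (2 * ν * Hker μ ν t x y + 2 * μ * tailKer μ μ t x y - 2 * reflKer μ t x y)

noncomputable def fullKerDt (μ ν t x y : ℝ) : ℝ :=
  (-1 / (2 * t) + (y - x) ^ 2 / (2 * t ^ 2) - μ ^ 2 / 2) * gaussKer μ x t y -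
    (-1 / (2 * t) + (x + y) ^ 2 / (2 * t ^ 2) - μ ^ 2 / 2) * reflKer μ t x y +
    2 * ν * (2 * ν * (ν - μ) * Hker μ ν t x y + 2 * μ * ν * tailKer μ μ t x y +
        ((x + y) / t - 2 * ν) * reflKer μ t x y)

theorem hasDerivAt_fullKer_y (μ ν x y : ℝ) {t : ℝ} (ht : 0 < t) :
    HasDerivAt (fullKer μ ν t x) (fullKerDy μ ν t x y) y :=
  ((hasDerivAt_gaussKer_y μ x y ht).sub (hasDerivAt_reflKer_y μ x y ht)).add
    ((hasDerivAt_Hker_y μ ν x y ht).const_mul (2 * ν))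

theorem hasDerivAt_fullKer_t (μ ν x y : ℝ) {t : ℝ} (ht : 0 < t) :
    HasDerivAt (fun t => fullKer μ ν t x y) (fullKerDt μ ν t x y) t :=
  ((hasDerivAt_gaussKer_t μ x y ht).sub (hasDerivAt_reflKer_t μ x y ht)).add
    ((hasDerivAt_Hker_t μ ν x y ht).const_mul (2 * ν))

/-- The kernel solves the adjoint equation `K_t = -μ K_y + K_yy / 2`. -/
theorem hasDerivAt_fullKerDy (μ ν x y : ℝ) {t : ℝ} (ht : 0 < t) :
    HasDerivAt (fullKerDy μ ν t x) (2 * (fullKerDt μ ν t x y + μ * fullKerDy μ ν t x y)) y := by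
  have hP := hasDerivAt_reflKer_y μ x y ht
  have h1 : HasDerivAt (fun y => (x - y) / t + μ) (-1 / t) y :=
    ((((hasDerivAt_id y).const_sub x)).div_const t).add_const μ
  have h2 : HasDerivAt (fun y => μ - (x + y) / t) (-(1 / t)) y :=
    ((((hasDerivAt_id y).const_add x)).div_const t).const_sub μ
  refine (((h1.mul (hasDerivAt_gaussKer_y μ x y ht)).sub (h2.mul hP)).add
    (((((hasDerivAt_Hker_y μ ν x y ht).const_mul (2 * ν)).add
      ((hasDerivAt_tailKer_y μ μ x y ht).const_mul (2 * μ))).sub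
      (hP.const_mul 2)).const_mul (2 * ν))).congr_deriv ?_
  unfold fullKerDt fullKerDy
  field_simp
  ring

theorem reflKer_zero_right (μ x : ℝ) {t : ℝ} (ht : 0 < t) :
    reflKer μ t x 0 = gaussKer μ x t 0 := by
  rw [reflKer_eq μ x 0 ht, gaussKer_eq]; simp

theorem fullKer_zero_right (μ ν x : ℝ) {t : ℝ} (ht : 0 < t) :
    fullKer μ ν t x 0 = 2 * ν * Hker μ ν t x 0 := by
  rw [fullKer, reflKer_zero_right μ x ht]; ring

theorem hasDerivAt_Hker_t_zero (μ ν x : ℝ) {t : ℝ} (ht : 0 < t) :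
    HasDerivAt (fun t => Hker μ ν t x 0)
      (fullKerDy μ ν t x 0 / 2 - μ * fullKer μ ν t x 0) t := by
  refine (hasDerivAt_Hker_t μ ν x 0 ht).congr_deriv ?_
  rw [fullKer_zero_right μ ν x ht, fullKerDy, ← reflKer_zero_right μ x ht]
  field_simp
  ring

/-- `F t y` decays in `y` faster than any exponential, uniformly for `t ∈ T`. -/
def ExpDecayOn (T : Set ℝ) (F : ℝ → ℝ → ℝ) : Prop :=
  ∀ m : ℝ, ∃ C : ℝ, ∀ t ∈ T, ∀ y ≥ (0 : ℝ), |F t y| ≤ C * Real.exp (-m * y)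

namespace ExpDecayOn

variable {T : Set ℝ} {F G : ℝ → ℝ → ℝ}

theorem mono {T' : Set ℝ} (hF : ExpDecayOn T F) (h : T' ⊆ T) : ExpDecayOn T' F := fun m =>
  let ⟨C, hC⟩ := hF m
  ⟨C, fun t ht => hC t (h ht)⟩

theorem congr (hF : ExpDecayOn T F) (h : ∀ t ∈ T, ∀ y, G t y = F t y) : ExpDecayOn T G := fun m =>
  let ⟨C, hC⟩ := hF m
  ⟨C, fun t ht y hy => by rw [h t ht y]; exact hC t ht y hy⟩

theorem add (hF : ExpDecayOn T F) (hG : ExpDecayOn T G) :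
    ExpDecayOn T fun t y => F t y + G t y := fun m => by
  obtain ⟨C, hC⟩ := hF m
  obtain ⟨D, hD⟩ := hG m
  refine ⟨C + D, fun t ht y hy => (abs_add_le _ _).trans ?_⟩
  linarith [hC t ht y hy, hD t ht y hy]

/-- Multiplication by a function of at most linear growth preserves decay. -/
theorem mul_left (hF : ExpDecayOn T F) {g : ℝ → ℝ → ℝ} (A : ℝ)
    (hg : ∀ t ∈ T, ∀ y ≥ (0 : ℝ), |g t y| ≤ A * (1 + y)) :
    ExpDecayOn T fun t y => g t y * F t y := fun m => by
  obtain ⟨C, hC⟩ := hF (m + 1)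
  refine ⟨A * C, fun t ht y hy => ?_⟩
  have hA : 0 ≤ A := nonneg_of_mul_nonneg_left ((abs_nonneg _).trans (hg t ht y hy)) (by linarith)
  have hexp : 1 + y ≤ Real.exp y := by linarith [Real.add_one_le_exp y]
  calc |g t y * F t y| = |g t y| * |F t y| := abs_mul _ _
    _ ≤ (A * Real.exp y) * (C * Real.exp (-(m + 1) * y)) :=
        mul_le_mul ((hg t ht y hy).trans (by gcongr)) (hC t ht y hy) (abs_nonneg _) (by positivity)
    _ = A * C * (Real.exp y * Real.exp (-(m + 1) * y)) := by ring
    _ = A * C * Real.exp (-m * y) := by rw [← Real.exp_add]; ring_nf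

theorem const_mul (hF : ExpDecayOn T F) (a : ℝ) : ExpDecayOn T fun t y => a * F t y :=
  hF.mul_left |a| fun t _ y hy => by nlinarith [mul_nonneg (abs_nonneg a) hy]

theorem sub (hF : ExpDecayOn T F) (hG : ExpDecayOn T G) :
    ExpDecayOn T fun t y => F t y - G t y :=
  (hF.add (hG.const_mul (-1))).congr fun t _ y => by ring

end ExpDecayOn

theorem sqrt_mul_gaussKer (μ c y : ℝ) {t : ℝ} (ht : 0 < t) :
    Real.sqrt t * gaussKer μ c t y = phi ((y - c - μ * t) / Real.sqrt t) := by
  have hs' := Real.sqrt_pos.2 ht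
  unfold gaussKer
  field_simp

theorem expDecayOn_sqrt_mul_gaussKer (μ c b : ℝ) :
    ExpDecayOn (Ioc 0 b) fun t y => Real.sqrt t * gaussKer μ c t y := fun m => by
  refine ⟨Real.exp (b * |m ^ 2 / 2 + m * μ| + m * c), fun t ht y hy => ?_⟩
  have hs := Real.sq_sqrt ht.1.le
  have hs' := Real.sqrt_pos.2 ht.1
  simp only [sqrt_mul_gaussKer μ c y ht.1]
  rw [abs_of_pos (phi_pos _), ← Real.exp_add]
  refine (phi_le_exp (m * Real.sqrt t) _).trans (Real.exp_le_exp.2 ?_)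
  rw [mul_pow, hs, mul_assoc, mul_div_cancel₀ _ hs'.ne']
  have h1 : t * (m ^ 2 / 2 + m * μ) ≤ b * |m ^ 2 / 2 + m * μ| :=
    (mul_le_mul_of_nonneg_left (le_abs_self _) ht.1.le).trans
      (mul_le_mul_of_nonneg_right ht.2 (abs_nonneg _))
  linarith

theorem expDecayOn_gaussKer (μ c : ℝ) {a b : ℝ} (ha : 0 < a) :
    ExpDecayOn (Icc a b) (gaussKer μ c) := by
  have h := (expDecayOn_sqrt_mul_gaussKer μ c b).mono
    (T' := Icc a b) fun t ht => ⟨ha.trans_le ht.1, ht.2⟩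
  refine (h.mul_left (g := fun t _ => 1 / Real.sqrt t) (1 / Real.sqrt a) fun t ht y hy => ?_).congr
    fun t ht y => ?_
  · have := Real.sqrt_pos.2 ha
    have h1 : 1 / Real.sqrt t ≤ 1 / Real.sqrt a :=
      one_div_le_one_div_of_le this (Real.sqrt_le_sqrt ht.1)
    rw [abs_of_nonneg (by positivity)]
    have : 0 < 1 / Real.sqrt a := by positivity
    nlinarith
  · have := Real.sqrt_pos.2 (ha.trans_le ht.1)
    field_simp

theorem expDecayOn_tailKer (μ κ x b : ℝ) :
    ExpDecayOn (Ioc 0 b) fun t y => tailKer μ κ t x y := fun m => by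
  set k := |2 * κ| + |m| with hk
  have hk0 : 0 ≤ k := by positivity
  set A := 2 * (κ - μ) * κ + k ^ 2 / 2 - k * (2 * κ - μ) with hA
  refine ⟨Real.exp (b * |A| + (2 * (κ - μ) - k) * x), fun t ht y hy => ?_⟩
  have hs := Real.sq_sqrt ht.1.le
  have hs' := Real.sqrt_pos.2 ht.1
  unfold tailKer
  rw [abs_of_nonneg (mul_nonneg (Real.exp_pos _).le (Psi_nonneg _))]
  refine (mul_le_mul_of_nonneg_left (Psi_le_exp (l := k * Real.sqrt t) (by positivity) _)
    (Real.exp_pos _).le).trans ?_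
  rw [← Real.exp_add, ← Real.exp_add]
  refine Real.exp_le_exp.2 ?_
  rw [mul_pow, hs, mul_assoc k, mul_div_cancel₀ _ hs'.ne']
  have h1 : t * A ≤ b * |A| :=
    (mul_le_mul_of_nonneg_left (le_abs_self A) ht.1.le).trans
      (mul_le_mul_of_nonneg_right ht.2 (abs_nonneg _))
  have h2 : (2 * κ - k) * y ≤ -m * y := by
    refine mul_le_mul_of_nonneg_right ?_ hy
    linarith [le_abs_self (2 * κ), le_abs_self m]
  rw [hA] at h1
  rw [hA]
  linarith

theorem expDecayOn_Hker (μ ν x b : ℝ) :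
    ExpDecayOn (Ioc 0 b) fun t y => Hker μ ν t x y := by
  have hE := expDecayOn_tailKer μ μ x b
  by_cases h : ν = μ
  · subst h
    have hP : ExpDecayOn (Ioc 0 b) fun t y => Real.sqrt t * (Real.sqrt t * reflKer ν t x y) := by
      refine (((expDecayOn_sqrt_mul_gaussKer ν (-x) b).const_mul (Real.exp (-2 * ν * x))).mul_left
        (g := fun t _ => Real.sqrt t) (Real.sqrt b) fun t ht y hy => ?_).congr fun t _ y => ?_
      · rw [abs_of_nonneg (Real.sqrt_nonneg _)]
        nlinarith [Real.sqrt_le_sqrt ht.2, mul_nonneg (Real.sqrt_nonneg b) hy]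
      · unfold reflKer; ring
    refine (((hE.mul_left (g := fun t y => 1 + ν * (x + y + ν * t))
      (1 + |ν| * (|x| + 1 + |ν| * b)) fun t ht y hy => ?_).sub (hP.const_mul ν)).const_mul 2).congr
      fun t ht y => ?_
    · have h1 : |ν * (x + y + ν * t)| ≤ |ν| * (|x| + y + |ν| * b) := by
        rw [abs_mul]
        refine mul_le_mul_of_nonneg_left ((abs_add_three _ _ _).trans ?_) (abs_nonneg _)
        rw [abs_of_nonneg hy, abs_mul ν t, abs_of_pos ht.1]
        nlinarith [abs_nonneg ν, ht.2]
      have h2 := abs_add_le 1 (ν * (x + y + ν * t))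
      rw [abs_one] at h2
      have hb := ht.1.le.trans ht.2
      have : 0 ≤ |ν| * (|x| + |ν| * b) * y := by positivity
      nlinarith [abs_nonneg ν]
    · rw [Hker_self ν x y ht.1]
      have hs := Real.mul_self_sqrt ht.1.le
      linear_combination 2 * ν * reflKer ν t x y * hs
  · refine ((((expDecayOn_tailKer μ ν x b).const_mul (2 * ν - μ)).sub
      (hE.const_mul μ)).const_mul (ν - μ)⁻¹).congr fun t _ y => ?_
    rw [Hker_eq_of_ne h]
    ring

theorem expDecayOn_reflKer (μ x : ℝ) {a b : ℝ} (ha : 0 < a) :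
    ExpDecayOn (Icc a b) fun t y => reflKer μ t x y :=
  (expDecayOn_gaussKer μ (-x) ha).const_mul _

theorem expDecayOn_fullKer (μ ν x : ℝ) {a b : ℝ} (ha : 0 < a) :
    ExpDecayOn (Icc a b) fun t y => fullKer μ ν t x y :=
  ((expDecayOn_gaussKer μ x ha).sub (expDecayOn_reflKer μ x ha)).add
    (((expDecayOn_Hker μ ν x b).mono fun _ ht => ⟨ha.trans_le ht.1, ht.2⟩).const_mul (2 * ν))

theorem expDecayOn_fullKerDy (μ ν x : ℝ) {a b : ℝ} (ha : 0 < a) :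
    ExpDecayOn (Icc a b) fun t y => fullKerDy μ ν t x y := by
  have hsub : Icc a b ⊆ Ioc 0 b := fun _ ht => ⟨ha.trans_le ht.1, ht.2⟩
  have hP := expDecayOn_reflKer μ x (b := b) ha
  have key : ∀ c d e : ℝ, |d| ≤ 1 → ∀ t ∈ Icc a b, ∀ y ≥ (0 : ℝ),
      |c / t + d * (y / t) + e| ≤ (|c| / a + 1 / a + |e|) * (1 + y) := by
    intro c d e hd t ht y hy
    have ht0 := ha.trans_le ht.1
    have h1 : |c / t| ≤ |c| / a := by rw [abs_div, abs_of_pos ht0]; gcongr; exact ht.1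
    have h2 : |d * (y / t)| ≤ y / a := by
      rw [abs_mul, abs_div, abs_of_pos ht0, abs_of_nonneg hy, ← one_mul (y / a)]
      gcongr
      exact ht.1
    refine (abs_add_three _ _ _).trans ?_
    have h3 : 0 ≤ (|c| / a + |e|) * y + 1 / a := by positivity
    have h4 : y / a = 1 / a * y := by ring
    nlinarith
  refine ((((expDecayOn_gaussKer μ x ha).mul_left (g := fun t y => x / t + -1 * (y / t) + μ) _
    (key x (-1) μ (by simp))).sub (hP.mul_left (g := fun t y => (-x) / t + -1 * (y / t) + μ) _
      (key (-x) (-1) μ (by simp)))).add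
    ((((((expDecayOn_Hker μ ν x b).mono hsub).const_mul (2 * ν)).add
      (((expDecayOn_tailKer μ μ x b).mono hsub).const_mul (2 * μ))).sub
      (hP.const_mul 2)).const_mul (2 * ν))).congr fun t ht y => ?_
  have ht0 := ha.trans_le ht.1
  unfold fullKerDy
  field_simp
  ring

theorem continuousOn_gaussKer (μ c : ℝ) :
    ContinuousOn (fun p : ℝ × ℝ => gaussKer μ c p.1 p.2) {p | 0 < p.1} := by
  have hs : ∀ p ∈ {p : ℝ × ℝ | 0 < p.1}, Real.sqrt p.1 ≠ 0 := fun p hp => (Real.sqrt_pos.2 hp).ne'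
  exact (continuousOn_const.div (by fun_prop) hs).mul
    (continuous_phi.comp_continuousOn (ContinuousOn.div (by fun_prop) (by fun_prop) hs))

theorem continuousOn_reflKer (μ x : ℝ) :
    ContinuousOn (fun p : ℝ × ℝ => reflKer μ p.1 x p.2) {p | 0 < p.1} :=
  continuousOn_const.mul (continuousOn_gaussKer μ (-x))

theorem continuousOn_tailKer (μ κ x : ℝ) :
    ContinuousOn (fun p : ℝ × ℝ => tailKer μ κ p.1 x p.2) {p | 0 < p.1} := by
  have hs : ∀ p ∈ {p : ℝ × ℝ | 0 < p.1}, Real.sqrt p.1 ≠ 0 := fun p hp => (Real.sqrt_pos.2 hp).ne'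
  exact ContinuousOn.mul (by fun_prop)
    (continuous_Psi.comp_continuousOn (ContinuousOn.div (by fun_prop) (by fun_prop) hs))

theorem continuousOn_Hker (μ ν x : ℝ) :
    ContinuousOn (fun p : ℝ × ℝ => Hker μ ν p.1 x p.2) {p | 0 < p.1} := by
  have hE := continuousOn_tailKer μ μ x
  by_cases h : ν = μ
  · subst h
    refine ContinuousOn.congr (f := fun p : ℝ × ℝ => 2 * ((1 + ν * (x + p.2 + ν * p.1)) *
      tailKer ν ν p.1 x p.2 - ν * p.1 * reflKer ν p.1 x p.2)) ?_ fun p hp => Hker_self ν x p.2 hp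
    exact continuousOn_const.mul ((ContinuousOn.mul (by fun_prop) hE).sub
      (ContinuousOn.mul (by fun_prop) (continuousOn_reflKer ν x)))
  · simp only [Hker_eq_of_ne h]
    exact ((continuousOn_const.mul (continuousOn_tailKer μ ν x)).sub
      (continuousOn_const.mul hE)).div_const _

theorem continuousOn_fullKer (μ ν x : ℝ) :
    ContinuousOn (fun p : ℝ × ℝ => fullKer μ ν p.1 x p.2) {p | 0 < p.1} :=
  ((continuousOn_gaussKer μ x).sub (continuousOn_reflKer μ x)).add
    (continuousOn_const.mul (continuousOn_Hker μ ν x))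

theorem continuousOn_fullKerDy (μ ν x : ℝ) :
    ContinuousOn (fun p : ℝ × ℝ => fullKerDy μ ν p.1 x p.2) {p | 0 < p.1} := by
  have hq := continuousOn_gaussKer μ x
  have hP := continuousOn_reflKer μ x
  have hE := continuousOn_tailKer μ μ x
  have hH := continuousOn_Hker μ ν x
  unfold fullKerDy
  have hs : ∀ p ∈ {p : ℝ × ℝ | 0 < p.1}, p.1 ≠ 0 := fun p hp => ne_of_gt hp
  fun_prop (disch := assumption)

theorem continuousOn_fullKerDt (μ ν x : ℝ) :
    ContinuousOn (fun p : ℝ × ℝ => fullKerDt μ ν p.1 x p.2) {p | 0 < p.1} := by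
  have hq := continuousOn_gaussKer μ x
  have hP := continuousOn_reflKer μ x
  have hE := continuousOn_tailKer μ μ x
  have hH := continuousOn_Hker μ ν x
  unfold fullKerDt
  have hs : ∀ p ∈ {p : ℝ × ℝ | 0 < p.1}, 2 * p.1 ≠ 0 := fun p hp => (mul_pos two_pos hp).ne'
  have hs1 : ∀ p ∈ {p : ℝ × ℝ | 0 < p.1}, p.1 ≠ 0 := fun p hp => ne_of_gt hp
  have hs' : ∀ p ∈ {p : ℝ × ℝ | 0 < p.1}, 2 * p.1 ^ 2 ≠ 0 :=
    fun p hp => (mul_pos two_pos (pow_pos hp 2)).ne'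
  fun_prop (disch := assumption)

theorem tendsto_tailKer_of_pos (μ κ : ℝ) {x y : ℝ} (hxy : 0 < x + y) :
    Tendsto (fun t => tailKer μ κ t x y) (nhdsWithin 0 (Ioi 0)) (nhds 0) := by
  have hsq : Tendsto Real.sqrt (nhdsWithin 0 (Ioi 0)) (nhdsWithin 0 (Ioi 0)) := by
    refine tendsto_nhdsWithin_iff.2 ⟨?_, ?_⟩
    · have := Real.continuous_sqrt.tendsto 0
      rw [Real.sqrt_zero] at this
      exact this.mono_left nhdsWithin_le_nhds
    · filter_upwards [self_mem_nhdsWithin] with t ht using Real.sqrt_pos.2 ht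
  have harg : Tendsto (fun t => (x + y + (2 * κ - μ) * t) / Real.sqrt t)
      (nhdsWithin 0 (Ioi 0)) atTop := by
    have h1 : Tendsto (fun t : ℝ => x + y + (2 * κ - μ) * t) (nhdsWithin 0 (Ioi 0))
        (nhds (x + y)) := by
      have : Continuous fun t : ℝ => x + y + (2 * κ - μ) * t := by fun_prop
      simpa using (this.tendsto 0).mono_left nhdsWithin_le_nhds
    simpa only [div_eq_mul_inv, Function.comp] using
      h1.pos_mul_atTop hxy (tendsto_inv_nhdsGT_zero.comp hsq)
  have hexp : Tendsto (fun t => Real.exp (2 * μ * y + 2 * (κ - μ) * (x + y + κ * t)))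
      (nhdsWithin 0 (Ioi 0)) (nhds (Real.exp (2 * μ * y + 2 * (κ - μ) * (x + y + κ * 0)))) := by
    have : Continuous fun t : ℝ => Real.exp (2 * μ * y + 2 * (κ - μ) * (x + y + κ * t)) := by
      fun_prop
    exact (this.tendsto 0).mono_left nhdsWithin_le_nhds
  simpa [tailKer] using hexp.mul (tendsto_Psi_atTop.comp harg)

theorem tendsto_tailKer_zero (μ κ : ℝ) :
    Tendsto (fun t => tailKer μ κ t 0 0) (nhdsWithin 0 (Ioi 0)) (nhds (1 / 2)) := by
  have hc : Continuous fun t : ℝ => Real.exp (2 * (κ - μ) * (κ * t)) *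
      Psi ((2 * κ - μ) * Real.sqrt t) := by
    have := continuous_Psi
    fun_prop
  have h := (hc.tendsto 0).mono_left (nhdsWithin_le_nhds (s := Ioi 0))
  simp only [mul_zero, Real.exp_zero, Real.sqrt_zero, Psi_zero, one_mul] at h
  refine h.congr' ?_
  filter_upwards [self_mem_nhdsWithin] with t ht
  simp [tailKer, mul_div_assoc, Real.div_sqrt]

theorem tendsto_mul_reflKer (μ x y : ℝ) :
    Tendsto (fun t => t * reflKer μ t x y) (nhdsWithin 0 (Ioi 0)) (nhds 0) := by
  have h : Tendsto (fun t => Real.sqrt t * Real.exp (-2 * μ * x)) (nhdsWithin 0 (Ioi 0))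
      (nhds 0) := by
    have hc : Continuous fun t : ℝ => Real.sqrt t * Real.exp (-2 * μ * x) := by fun_prop
    simpa using (hc.tendsto 0).mono_left (nhdsWithin_le_nhds (s := Ioi 0))
  refine squeeze_zero_norm' ?_ h
  filter_upwards [self_mem_nhdsWithin] with t (ht : 0 < t)
  have h1 : t * reflKer μ t x y = Real.sqrt t * Real.exp (-2 * μ * x) *
      phi ((y - -x - μ * t) / Real.sqrt t) := by
    rw [← sqrt_mul_gaussKer μ (-x) y ht, reflKer]
    linear_combination (-(Real.exp (-2 * μ * x) * gaussKer μ (-x) t y)) * Real.mul_self_sqrt ht.le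
  rw [h1, Real.norm_eq_abs, abs_of_nonneg
    (by have := (phi_pos ((y - -x - μ * t) / Real.sqrt t)).le; positivity)]
  refine mul_le_of_le_one_right (by positivity) ?_
  simpa using phi_le_exp 0 ((y - -x - μ * t) / Real.sqrt t)

theorem tendsto_Hker_self (μ x y l : ℝ)
    (hE : Tendsto (fun t => tailKer μ μ t x y) (nhdsWithin 0 (Ioi 0)) (nhds l)) :
    Tendsto (fun t => Hker μ μ t x y) (nhdsWithin 0 (Ioi 0))
      (nhds (2 * ((1 + μ * (x + y)) * l))) := by
  have hc : Continuous fun t : ℝ => 1 + μ * (x + y + μ * t) := by fun_prop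
  have h1 := (hc.tendsto 0).mono_left (nhdsWithin_le_nhds (s := Ioi 0))
  have h := (((h1.mul hE).sub ((tendsto_mul_reflKer μ x y).const_mul μ)).const_mul 2)
  simp only [mul_zero, add_zero, sub_zero] at h
  refine h.congr' ?_
  filter_upwards [self_mem_nhdsWithin] with t ht
  rw [Hker_self μ x y ht]
  ring

theorem tendsto_Hker_of_pos (μ ν : ℝ) {x y : ℝ} (hxy : 0 < x + y) :
    Tendsto (fun t => Hker μ ν t x y) (nhdsWithin 0 (Ioi 0)) (nhds 0) := by
  have hE := tendsto_tailKer_of_pos μ μ hxy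
  by_cases h : ν = μ
  · subst h
    simpa using tendsto_Hker_self ν x y 0 hE
  · simp only [Hker_eq_of_ne h]
    simpa using (((tendsto_tailKer_of_pos μ ν hxy).const_mul (2 * ν - μ)).sub
      (hE.const_mul μ)).div_const (ν - μ)

theorem tendsto_Hker_zero (μ ν : ℝ) :
    Tendsto (fun t => Hker μ ν t 0 0) (nhdsWithin 0 (Ioi 0)) (nhds 1) := by
  have hE := tendsto_tailKer_zero μ μ
  by_cases h : ν = μ
  · subst h
    simpa using tendsto_Hker_self ν 0 0 _ hE
  · simp only [Hker_eq_of_ne h]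
    have h' : ν - μ ≠ 0 := sub_ne_zero.2 h
    have := (((tendsto_tailKer_zero μ ν).const_mul (2 * ν - μ)).sub
      (hE.const_mul μ)).div_const (ν - μ)
    convert this using 2
    field_simp
    ring

/-- The half-strip on which solutions are smooth. -/
abbrev halfStrip : Set (ℝ × ℝ) := Ioi 0 ×ˢ Ici 0

theorem uniqueDiffOn_halfStrip : UniqueDiffOn ℝ halfStrip :=
  (uniqueDiffOn_Ioi 0).prod (uniqueDiffOn_Ici 0)

section Regularity

variable {F : ℝ × ℝ → ℝ}

theorem hasDerivAt_fst_of_contDiffOn (hF : ContDiffOn ℝ (⊤ : ℕ∞) F halfStrip) {s y : ℝ}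
    (hs : 0 < s) (hy : 0 ≤ y) :
    HasDerivAt (fun r => F (r, y)) (fderivWithin ℝ F halfStrip (s, y) (1, 0)) s := by
  have h : HasFDerivWithinAt F (fderivWithin ℝ F halfStrip (s, y)) halfStrip (s, y) :=
    ((hF.differentiableOn (by simp)) (s, y) ⟨hs, hy⟩).hasFDerivWithinAt
  have h1 : HasDerivAt (fun r : ℝ => (r, y)) ((1 : ℝ), (0 : ℝ)) s :=
    (hasDerivAt_id s).prodMk (hasDerivAt_const s y)
  exact h.comp_hasDerivAt s h1 (by filter_upwards [lt_mem_nhds hs] with r hr using ⟨hr, hy⟩)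

theorem hasDerivWithinAt_snd_of_contDiffOn (hF : ContDiffOn ℝ (⊤ : ℕ∞) F halfStrip) {s y : ℝ}
    (hs : 0 < s) (hy : 0 ≤ y) :
    HasDerivWithinAt (fun z => F (s, z)) (fderivWithin ℝ F halfStrip (s, y) (0, 1)) (Ici 0) y := by
  have h : HasFDerivWithinAt F (fderivWithin ℝ F halfStrip (s, y)) halfStrip (s, y) :=
    ((hF.differentiableOn (by simp)) (s, y) ⟨hs, hy⟩).hasFDerivWithinAt
  have h1 : HasDerivWithinAt (fun z : ℝ => (s, z)) ((0 : ℝ), (1 : ℝ)) (Ici 0) y :=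
    (hasDerivWithinAt_const y _ s).prodMk (hasDerivWithinAt_id y _)
  exact h.comp_hasDerivWithinAt y h1 fun z hz => ⟨hs, hz⟩

theorem contDiffOn_dirDeriv_halfStrip (hF : ContDiffOn ℝ (⊤ : ℕ∞) F halfStrip) (v : ℝ × ℝ) :
    ContDiffOn ℝ (⊤ : ℕ∞) (fun p => fderivWithin ℝ F halfStrip p v) halfStrip :=
  (hF.fderivWithin uniqueDiffOn_halfStrip (by simp)).clm_apply contDiffOn_const

variable {u : ℝ → ℝ → ℝ}

theorem ut_eq (hu : ContDiffOn ℝ (⊤ : ℕ∞) (fun p : ℝ × ℝ => u p.1 p.2) halfStrip)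
    {s y : ℝ} (hs : 0 < s) (hy : 0 ≤ y) :
    ut u s y = fderivWithin ℝ (fun p : ℝ × ℝ => u p.1 p.2) halfStrip (s, y) (1, 0) :=
  (hasDerivAt_fst_of_contDiffOn hu hs hy).deriv

theorem ux_eq (hu : ContDiffOn ℝ (⊤ : ℕ∞) (fun p : ℝ × ℝ => u p.1 p.2) halfStrip)
    {s y : ℝ} (hs : 0 < s) (hy : 0 ≤ y) :
    ux u s y = fderivWithin ℝ (fun p : ℝ × ℝ => u p.1 p.2) halfStrip (s, y) (0, 1) :=
  (hasDerivWithinAt_snd_of_contDiffOn hu hs hy).derivWithin (uniqueDiffOn_Ici 0 y hy)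

theorem hasDerivAt_ut (hu : ContDiffOn ℝ (⊤ : ℕ∞) (fun p : ℝ × ℝ => u p.1 p.2) halfStrip)
    {s y : ℝ} (hs : 0 < s) (hy : 0 ≤ y) : HasDerivAt (fun r => u r y) (ut u s y) s :=
  (hasDerivAt_fst_of_contDiffOn hu hs hy).differentiableAt.hasDerivAt

theorem hasDerivWithinAt_ux (hu : ContDiffOn ℝ (⊤ : ℕ∞) (fun p : ℝ × ℝ => u p.1 p.2) halfStrip)
    {s y : ℝ} (hs : 0 < s) (hy : 0 ≤ y) : HasDerivWithinAt (u s) (ux u s y) (Ici 0) y :=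
  (hasDerivWithinAt_snd_of_contDiffOn hu hs hy).differentiableWithinAt.hasDerivWithinAt

theorem hasDerivWithinAt_uxx (hu : ContDiffOn ℝ (⊤ : ℕ∞) (fun p : ℝ × ℝ => u p.1 p.2) halfStrip)
    {s y : ℝ} (hs : 0 < s) (hy : 0 ≤ y) : HasDerivWithinAt (ux u s) (uxx u s y) (Ici 0) y :=
  ((hasDerivWithinAt_snd_of_contDiffOn (contDiffOn_dirDeriv_halfStrip hu (0, 1)) hs hy).congr
    (fun _ hz => ux_eq hu hs hz) (ux_eq hu hs hy)).differentiableWithinAt.hasDerivWithinAt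

theorem continuousOn_ut (hu : ContDiffOn ℝ (⊤ : ℕ∞) (fun p : ℝ × ℝ => u p.1 p.2) halfStrip) :
    ContinuousOn (fun p : ℝ × ℝ => ut u p.1 p.2) halfStrip :=
  (contDiffOn_dirDeriv_halfStrip hu (1, 0)).continuousOn.congr fun _ hp => ut_eq hu hp.1 hp.2

end Regularity

/-- Green's formula on a rectangle for a density `f` and a flux `g` with `f_s = g_y = h`. -/
theorem integral_rectangle_of_conservation {f g h : ℝ → ℝ → ℝ} {a b R : ℝ} (hab : a ≤ b)
    (hR : 0 ≤ R) (hf : ∀ y ∈ Icc 0 R, ∀ s ∈ Icc a b, HasDerivAt (fun r => f r y) (h s y) s)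
    (hg : ∀ s ∈ Icc a b, ∀ y ∈ Icc 0 R, HasDerivWithinAt (g s) (h s y) (Ici 0) y)
    (hc : ContinuousOn (fun p : ℝ × ℝ => h p.1 p.2) (Icc a b ×ˢ Icc 0 R)) :
    ∫ y in (0 : ℝ)..R, (f b y - f a y) = ∫ s in a..b, (g s R - g s 0) := by
  have h1 : ∀ y ∈ Icc 0 R, ∫ s in a..b, h s y = f b y - f a y := fun y hy => by
    refine intervalIntegral.integral_eq_sub_of_hasDerivAt (f := fun r => f r y) ?_ ?_
    · rw [uIcc_of_le hab]; exact hf y hy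
    · refine ContinuousOn.intervalIntegrable ?_
      rw [uIcc_of_le hab]
      exact hc.comp (f := fun s => (s, y)) (by fun_prop) fun s hs => ⟨hs, hy⟩
  have h2 : ∀ s ∈ Icc a b, ∫ y in (0 : ℝ)..R, h s y = g s R - g s 0 := fun s hs => by
    refine intervalIntegral.integral_eq_sub_of_hasDeriv_right (f := g s) ?_ ?_ ?_
    · rw [uIcc_of_le hR]
      exact fun y hy => (hg s hs y hy).continuousWithinAt.mono Icc_subset_Ici_self
    · rw [min_eq_left hR, max_eq_right hR]
      exact fun y hy => (hg s hs y (Ioo_subset_Icc_self hy)).mono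
        fun z hz => hy.1.le.trans (le_of_lt hz)
    · refine ContinuousOn.intervalIntegrable ?_
      rw [uIcc_of_le hR]
      exact hc.comp (f := fun y => (s, y)) (by fun_prop) fun y hy => ⟨hs, hy⟩
  rw [← uIcc_of_le hab, ← uIcc_of_le hR] at *
  rw [← intervalIntegral.integral_congr h1, ← intervalIntegral.integral_congr h2]
  refine (MeasureTheory.intervalIntegral_intervalIntegral_swap (F := h) ?_).symm
  exact (hc.integrableOn_compact (isCompact_uIcc.prod isCompact_uIcc)).mono_set
    (prod_mono uIoc_subset_uIcc uIoc_subset_uIcc)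

section Limits

variable {u : ℝ → ℝ → ℝ} {b C : ℝ}

theorem continuousOn_snd_of_prod
    (huc : ContinuousOn (fun p : ℝ × ℝ => u p.1 p.2) (Icc 0 b ×ˢ Ici 0))
    {s : ℝ} (hs : s ∈ Icc 0 b) : ContinuousOn (u s) (Ici 0) :=
  huc.comp (f := fun y => (s, y)) (by fun_prop) fun _ hy => ⟨hs, hy⟩

theorem integrableOn_mul_of_expDecayOn
    (huc : ContinuousOn (fun p : ℝ × ℝ => u p.1 p.2) (Icc 0 b ×ˢ Ici 0))
    (hC : ∀ s ∈ Icc 0 b, ∀ y ≥ (0 : ℝ), |u s y| ≤ C) {T : Set ℝ} {F : ℝ → ℝ → ℝ}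
    (hF : ExpDecayOn T F) {s r : ℝ} (hs : s ∈ Icc 0 b) (hr : r ∈ T) (hFc : Continuous (F r)) :
    IntegrableOn (fun y => u s y * F r y) (Ioi 0) := by
  obtain ⟨D, hD⟩ := hF 1
  refine ((exp_neg_integrableOn_Ioi 0 one_pos).const_mul (C * D)).mono' ?_ ?_
  · exact (((continuousOn_snd_of_prod huc hs).mono Ioi_subset_Ici_self).mul
      hFc.continuousOn).aestronglyMeasurable measurableSet_Ioi
  · refine (ae_restrict_iff' measurableSet_Ioi).2 (ae_of_all _ fun y (hy : 0 < y) => ?_)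
    rw [Real.norm_eq_abs, abs_mul, mul_assoc]
    exact mul_le_mul (hC s hs y hy.le) (hD r hr y hy.le) (abs_nonneg _)
      ((abs_nonneg _).trans (hC s hs y hy.le))

theorem tendsto_integral_mul_of_expDecayOn
    (huc : ContinuousOn (fun p : ℝ × ℝ => u p.1 p.2) (Icc 0 b ×ˢ Ici 0))
    (hC : ∀ s ∈ Icc 0 b, ∀ y ≥ (0 : ℝ), |u s y| ≤ C) {T : Set ℝ} {F : ℝ → ℝ → ℝ}
    (hF : ExpDecayOn T F) (hFc : ∀ r ∈ T, Continuous (F r)) {l : Filter ℝ}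
    [l.IsCountablyGenerated] {σ τ : ℝ → ℝ} (hσ : ∀ᶠ r in l, σ r ∈ Icc 0 b)
    (hτ : ∀ᶠ r in l, τ r ∈ T) {L : ℝ → ℝ}
    (hlim : ∀ y > 0, Tendsto (fun r => u (σ r) y * F (τ r) y) l (nhds (L y))) :
    Tendsto (fun r => ∫ y in Ioi 0, u (σ r) y * F (τ r) y) l (nhds (∫ y in Ioi 0, L y)) := by
  obtain ⟨D, hD⟩ := hF 1
  refine tendsto_integral_filter_of_dominated_convergence
    (fun y => C * D * Real.exp (-1 * y)) ?_ ?_ ?_ ?_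
  · filter_upwards [hσ, hτ] with r hr hr'
    exact (integrableOn_mul_of_expDecayOn huc hC hF hr hr' (hFc _ hr')).aestronglyMeasurable
  · filter_upwards [hσ, hτ] with r hr hr'
    refine (ae_restrict_iff' measurableSet_Ioi).2 (ae_of_all _ fun y (hy : 0 < y) => ?_)
    rw [Real.norm_eq_abs, abs_mul, mul_assoc]
    exact mul_le_mul (hC _ hr y hy.le) (hD _ hr' y hy.le) (abs_nonneg _)
      ((abs_nonneg _).trans (hC _ hr y hy.le))
  · exact (exp_neg_integrableOn_Ioi 0 one_pos).const_mul (C * D)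
  · exact (ae_restrict_iff' measurableSet_Ioi).2 (ae_of_all _ hlim)

theorem tendsto_backward {t : ℝ} (ht : 0 < t) :
    Tendsto (fun r => t - r) (nhdsWithin 0 (Ioi 0)) (nhdsWithin t (Icc 0 t)) := by
  refine tendsto_nhdsWithin_iff.2 ⟨?_, ?_⟩
  · have : Continuous fun r : ℝ => t - r := by fun_prop
    simpa using (this.tendsto 0).mono_left nhdsWithin_le_nhds
  · filter_upwards [Ioc_mem_nhdsGT ht] with r hr
    exact ⟨by linarith [hr.2], by linarith [hr.1]⟩

theorem tendsto_backward_apply {t : ℝ} (ht : 0 < t)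
    (huc : ContinuousOn (fun p : ℝ × ℝ => u p.1 p.2) (Icc 0 t ×ˢ Ici 0)) {Y : ℝ → ℝ} {c : ℝ}
    (hc : 0 ≤ c) (hY : Tendsto Y (nhdsWithin 0 (Ioi 0)) (nhds c))
    (hY0 : ∀ᶠ r in nhdsWithin 0 (Ioi 0), 0 ≤ Y r) :
    Tendsto (fun r => u (t - r) (Y r)) (nhdsWithin 0 (Ioi 0)) (nhds (u t c)) := by
  have h := huc (t, c) ⟨⟨ht.le, le_rfl⟩, hc⟩
  have hpair : Tendsto (fun r => (t - r, Y r)) (nhdsWithin 0 (Ioi 0))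
      (nhdsWithin (t, c) (Icc 0 t ×ˢ Ici 0)) := by
    rw [nhdsWithin_prod_eq]
    exact (tendsto_backward ht).prodMk (tendsto_nhdsWithin_iff.2 ⟨hY, hY0⟩)
  exact Tendsto.comp (f := fun r => (t - r, Y r)) h hpair

/-- `gaussKer μ c` is an approximate identity at `c`. -/
theorem tendsto_integral_gaussKer (μ : ℝ) {t c : ℝ} (ht : 0 < t) (hc : c ≠ 0)
    (huc : ContinuousOn (fun p : ℝ × ℝ => u p.1 p.2) (Icc 0 t ×ˢ Ici 0))
    (hC : ∀ s ∈ Icc 0 t, ∀ y ≥ (0 : ℝ), |u s y| ≤ C) :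
    Tendsto (fun r => ∫ y in Ioi 0, u (t - r) y * gaussKer μ c r y) (nhdsWithin 0 (Ioi 0))
      (nhds (if 0 < c then u t c else 0)) := by
  set w : ℝ → ℝ → ℝ := fun r => (Ioi 0).indicator fun y => u (t - r) (max y 0) with hw
  set Y : ℝ → ℝ → ℝ := fun r z => Real.sqrt r * z + (c + μ * r) with hYdef
  have hC0 : 0 ≤ C := (abs_nonneg _).trans (hC 0 ⟨le_rfl, ht.le⟩ 0 le_rfl)
  have hmem : ∀ᶠ r in nhdsWithin (0 : ℝ) (Ioi 0), 0 < r ∧ t - r ∈ Icc 0 t := by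
    filter_upwards [Ioc_mem_nhdsGT ht] with r hr
    exact ⟨hr.1, by linarith [hr.2], by linarith [hr.1]⟩
  have hsubst : ∀ r, 0 < r → ∫ y in Ioi 0, u (t - r) y * gaussKer μ c r y =
      ∫ z, w r (Y r z) * phi z := by
    intro r hr
    have hs := Real.sqrt_pos.2 hr
    rw [← integral_indicator measurableSet_Ioi]
    have e1 : (Ioi 0).indicator (fun y => u (t - r) y * gaussKer μ c r y) =
        fun y => w r y * gaussKer μ c r y := by
      ext y
      by_cases hy : 0 < y
      · simp [hw, hy, max_eq_left hy.le]
      · simp [hw, hy]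
    rw [e1]
    have e2 := integral_add_right_eq_self (μ := volume)
      (fun y => w r y * gaussKer μ c r y) (c + μ * r)
    have e3 := Measure.integral_comp_mul_left
      (fun y => w r (y + (c + μ * r)) * gaussKer μ c r (y + (c + μ * r))) (Real.sqrt r)
    rw [← e2]
    have e4 : ∀ z, w r (Real.sqrt r * z + (c + μ * r)) *
        gaussKer μ c r (Real.sqrt r * z + (c + μ * r)) =
        (Real.sqrt r)⁻¹ * (w r (Y r z) * phi z) := by
      intro z
      have : (Real.sqrt r * z + (c + μ * r) - c - μ * r) / Real.sqrt r = z := by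
        field_simp; ring
      rw [gaussKer, this]
      simp only [hYdef]
      ring
    simp only [e4, integral_const_mul, smul_eq_mul, abs_of_pos (inv_pos.2 hs)] at e3
    exact (mul_left_cancel₀ (inv_pos.2 hs).ne' e3).symm
  have hYlim : ∀ z, Tendsto (fun r => Y r z) (nhdsWithin 0 (Ioi 0)) (nhds c) := by
    intro z
    have : Continuous fun r => Y r z := by simp only [hYdef]; fun_prop
    simpa [hYdef] using (this.tendsto 0).mono_left (nhdsWithin_le_nhds (s := Ioi 0))
  have hlim : ∫ z, (if 0 < c then u t c else 0) * phi z = if 0 < c then u t c else 0 := by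
    rw [integral_const_mul, integral_phi, mul_one]
  rw [← hlim]
  refine Tendsto.congr' (f₁ := fun r => ∫ z, w r (Y r z) * phi z) ?_ ?_
  · filter_upwards [self_mem_nhdsWithin] with r hr using (hsubst r hr).symm
  refine tendsto_integral_filter_of_dominated_convergence (fun z => C * phi z) ?_ ?_
    (integrable_phi.const_mul C) (ae_of_all _ fun z => ?_)
  · filter_upwards [hmem] with r hr
    have hcont : Continuous fun y => u (t - r) (max y 0) :=
      (continuousOn_snd_of_prod huc hr.2).comp_continuous (by fun_prop) fun y => le_max_right y 0
    have hYm : Measurable (Y r) := by simp only [hYdef]; fun_prop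
    exact (((hcont.measurable.indicator measurableSet_Ioi).comp hYm).mul
      continuous_phi.measurable).aestronglyMeasurable
  · filter_upwards [hmem] with r hr
    refine ae_of_all _ fun z => ?_
    rw [norm_mul, Real.norm_of_nonneg (phi_pos z).le]
    refine mul_le_mul_of_nonneg_right ?_ (phi_pos z).le
    by_cases hy : 0 < Y r z
    · simpa [hw, hy] using hC _ hr.2 _ (le_max_right (Y r z) 0)
    · simpa [hw, hy] using hC0
  · refine Tendsto.mul_const _ ?_
    rcases hc.lt_or_gt with hneg | hpos
    · rw [if_neg hneg.not_gt]
      refine tendsto_const_nhds.congr' ?_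
      filter_upwards [(hYlim z).eventually (gt_mem_nhds hneg)] with r hr
      simp [hw, hr.le]
    · rw [if_pos hpos]
      have hev := (hYlim z).eventually (lt_mem_nhds hpos)
      refine (tendsto_backward_apply ht huc hpos.le (hYlim z) (hev.mono fun _ h => h.le)).congr' ?_
      filter_upwards [hev] with r hr
      simp [hw, hr, max_eq_left hr.le]

end Limits

section Solution

variable {μ ν : ℝ} {f : ℝ → ℝ} {u : ℝ → ℝ → ℝ}

theorem continuous_fullKer (μ ν x : ℝ) {t : ℝ} (ht : 0 < t) : Continuous (fullKer μ ν t x) :=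
  continuous_iff_continuousAt.2 fun y => (hasDerivAt_fullKer_y μ ν x y ht).continuousAt

/-- The flux of `u(s, y) K(t - s; x, y)`, where `K` is the full kernel. -/
noncomputable def flux (μ ν t x : ℝ) (u : ℝ → ℝ → ℝ) (s y : ℝ) : ℝ :=
  (μ * u s y + ux u s y / 2) * fullKer μ ν (t - s) x y - u s y / 2 * fullKerDy μ ν (t - s) x y

theorem hasDerivWithinAt_flux (hu : IsSWSolution μ ν f u) (x : ℝ) {t s y : ℝ} (hs : 0 < s)
    (hst : s < t) (hy : 0 ≤ y) :
    HasDerivWithinAt (flux μ ν t x u s)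
      (ut u s y * fullKer μ ν (t - s) x y - u s y * fullKerDt μ ν (t - s) x y) (Ici 0) y := by
  have ht : 0 < t - s := sub_pos.2 hst
  have h0 := hasDerivWithinAt_ux hu.1 hs hy
  have h1 := hasDerivWithinAt_uxx hu.1 hs hy
  have hK := (hasDerivAt_fullKer_y μ ν x y ht).hasDerivWithinAt (s := Ici 0)
  have hK' := (hasDerivAt_fullKerDy μ ν x y ht).hasDerivWithinAt (s := Ici 0)
  have h := (((h0.const_mul μ).add (h1.div_const 2)).mul hK).sub ((h0.div_const 2).mul hK')
  refine h.congr_deriv ?_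
  rw [hu.2.2.2.1 s hs y hy]
  simp only [Pi.add_apply]
  ring

theorem hasDerivAt_mul_fullKer (hu : IsSWSolution μ ν f u) (x : ℝ) {t s y : ℝ} (hs : 0 < s)
    (hst : s < t) (hy : 0 ≤ y) :
    HasDerivAt (fun s => u s y * fullKer μ ν (t - s) x y)
      (ut u s y * fullKer μ ν (t - s) x y - u s y * fullKerDt μ ν (t - s) x y) s := by
  have ht : 0 < t - s := sub_pos.2 hst
  have h := (hasDerivAt_ut hu.1 hs hy).mul
    ((hasDerivAt_fullKer_t μ ν x y ht).comp_const_sub t s)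
  exact h.congr_deriv (by ring)

theorem hasDerivAt_boundary (hu : IsSWSolution μ ν f u) (x : ℝ) {t s : ℝ} (hs : 0 < s)
    (hst : s < t) :
    HasDerivAt (fun s => u s 0 * Hker μ ν (t - s) x 0) (flux μ ν t x u s 0) s := by
  have ht : 0 < t - s := sub_pos.2 hst
  have h := (hasDerivAt_ut hu.1 hs le_rfl).mul
    ((hasDerivAt_Hker_t_zero μ ν x ht).comp_const_sub t s)
  refine h.congr_deriv ?_
  rw [hu.2.2.2.2.2 s hs, flux, fullKer_zero_right μ ν x ht]
  ring

theorem continuousOn_backward {t a b y : ℝ} (hbt : b < t) {K : ℝ → ℝ → ℝ}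
    (hK : ContinuousOn (fun p : ℝ × ℝ => K p.1 p.2) {p | 0 < p.1}) :
    ContinuousOn (fun s => K (t - s) y) (Icc a b) :=
  hK.comp (f := fun s => (t - s, y)) (by fun_prop) fun s hs => by
    simpa using hs.2.trans_lt hbt

theorem intervalIntegrable_flux (hu : IsSWSolution μ ν f u) (x : ℝ) {t a b y : ℝ} (ha : 0 < a)
    (hab : a ≤ b) (hbt : b < t) (hy : 0 ≤ y) :
    IntervalIntegrable (fun s => flux μ ν t x u s y) volume a b := by
  refine ContinuousOn.intervalIntegrable ?_
  rw [uIcc_of_le hab]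
  obtain ⟨h0, h1, -⟩ := hu.2.1 b (ha.trans_le hab)
  have hm : MapsTo (fun s : ℝ => (s, y)) (Icc a b) (Icc 0 b ×ˢ Ici 0) :=
    fun s hs => ⟨⟨ha.le.trans hs.1, hs.2⟩, hy⟩
  have c0 : ContinuousOn (fun s => u s y) (Icc a b) :=
    h0.comp (f := fun s => (s, y)) (by fun_prop) hm
  have c1 : ContinuousOn (fun s => ux u s y) (Icc a b) :=
    h1.comp (f := fun s => (s, y)) (by fun_prop) hm
  have k0 := continuousOn_backward (a := a) (y := y) (K := fun r => fullKer μ ν r x) hbt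
    (continuousOn_fullKer μ ν x)
  have k1 := continuousOn_backward (a := a) (y := y) (K := fun r => fullKerDy μ ν r x) hbt
    (continuousOn_fullKerDy μ ν x)
  exact (((c0.const_mul μ).add (c1.div_const 2)).mul k0).sub ((c0.div_const 2).mul k1)

theorem tendsto_integral_flux_atTop (hu : IsSWSolution μ ν f u) (x : ℝ) {t a b : ℝ} (ha : 0 < a)
    (hab : a ≤ b) (hbt : b < t) :
    Tendsto (fun R => ∫ s in a..b, flux μ ν t x u s R) atTop (nhds 0) := by
  obtain ⟨-, -, C, hC⟩ := hu.2.1 b (ha.trans_le hab)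
  obtain ⟨D, hD⟩ := expDecayOn_fullKer (b := t - a) μ ν x (sub_pos.2 hbt) 1
  obtain ⟨E, hE⟩ := expDecayOn_fullKerDy (b := t - a) μ ν x (sub_pos.2 hbt) 1
  have hlim : Tendsto (fun R : ℝ =>
      ((|μ| * C + C / 2) * D + C / 2 * E) * Real.exp (-1 * R) * |b - a|) atTop (nhds 0) := by
    have := Real.tendsto_exp_neg_atTop_nhds_zero.const_mul ((|μ| * C + C / 2) * D + C / 2 * E)
    simpa using this.mul_const |b - a|
  refine squeeze_zero_norm' ?_ hlim
  filter_upwards [eventually_ge_atTop 0] with R hR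
  refine intervalIntegral.norm_integral_le_of_norm_le_const fun s hs => ?_
  rw [uIoc_of_le hab] at hs
  obtain ⟨h0, h1⟩ := hC (s, R) ⟨⟨ha.le.trans hs.1.le, hs.2⟩, hR⟩
  have hmem : t - s ∈ Icc (t - b) (t - a) := ⟨by linarith [hs.2], by linarith [hs.1]⟩
  have hk := hD _ hmem R hR
  have hk' := hE _ hmem R hR
  have hC0 := (abs_nonneg _).trans h0
  calc ‖flux μ ν t x u s R‖
      ≤ |(μ * u s R + ux u s R / 2) * fullKer μ ν (t - s) x R| +
          |u s R / 2 * fullKerDy μ ν (t - s) x R| := abs_sub _ _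
    _ ≤ (|μ| * C + C / 2) * (D * Real.exp (-1 * R)) + C / 2 * (E * Real.exp (-1 * R)) := by
      rw [abs_mul, abs_mul (u s R / 2), abs_div, abs_two]
      gcongr
      refine (abs_add_le _ _).trans ?_
      rw [abs_mul, abs_div, abs_two]
      gcongr
    _ = _ := by ring

/-- The pairing of the solution at time `s` with the kernel at the remaining time `t - s`. -/
noncomputable def pairing (μ ν t x : ℝ) (u : ℝ → ℝ → ℝ) (s : ℝ) : ℝ :=
  (∫ y in Ioi 0, u s y * fullKer μ ν (t - s) x y) + u s 0 * Hker μ ν (t - s) x 0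

theorem IsSWSolution.exists_bound (hu : IsSWSolution μ ν f u) {t : ℝ} (ht : 0 < t) :
    ContinuousOn (fun p : ℝ × ℝ => u p.1 p.2) (Icc 0 t ×ˢ Ici 0) ∧
      ∃ C, ∀ s ∈ Icc 0 t, ∀ y ≥ (0 : ℝ), |u s y| ≤ C := by
  obtain ⟨h0, -, C, hC⟩ := hu.2.1 t ht
  exact ⟨h0, C, fun s hs y hy => (hC (s, y) ⟨hs, hy⟩).1⟩

theorem pairing_eq_of_le (hu : IsSWSolution μ ν f u) (x : ℝ) {t a b : ℝ} (ha : 0 < a)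
    (hab : a ≤ b) (hbt : b < t) : pairing μ ν t x u a = pairing μ ν t x u b := by
  have hrect : ∀ R ≥ (0 : ℝ), ∫ y in (0 : ℝ)..R,
      (u b y * fullKer μ ν (t - b) x y - u a y * fullKer μ ν (t - a) x y) =
      (∫ s in a..b, flux μ ν t x u s R) -
        (u b 0 * Hker μ ν (t - b) x 0 - u a 0 * Hker μ ν (t - a) x 0) := by
    intro R hR
    have hbd : ∫ s in a..b, flux μ ν t x u s 0 =
        u b 0 * Hker μ ν (t - b) x 0 - u a 0 * Hker μ ν (t - a) x 0 := by
      refine intervalIntegral.integral_eq_sub_of_hasDerivAt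
        (f := fun s => u s 0 * Hker μ ν (t - s) x 0) (fun s hs => ?_)
        (intervalIntegrable_flux hu x ha hab hbt le_rfl)
      rw [uIcc_of_le hab] at hs
      exact hasDerivAt_boundary hu x (ha.trans_le hs.1) (hs.2.trans_lt hbt)
    rw [← hbd, ← intervalIntegral.integral_sub (intervalIntegrable_flux hu x ha hab hbt hR)
      (intervalIntegrable_flux hu x ha hab hbt le_rfl)]
    refine integral_rectangle_of_conservation
      (f := fun s y => u s y * fullKer μ ν (t - s) x y)
      (h := fun s y => ut u s y * fullKer μ ν (t - s) x y - u s y * fullKerDt μ ν (t - s) x y)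
      hab hR ?_ ?_ ?_
    · exact fun y hy s hs =>
        hasDerivAt_mul_fullKer hu x (ha.trans_le hs.1) (hs.2.trans_lt hbt) hy.1
    · exact fun s hs y hy =>
        hasDerivWithinAt_flux hu x (ha.trans_le hs.1) (hs.2.trans_lt hbt) hy.1
    · have hm : Icc a b ×ˢ Icc 0 R ⊆ halfStrip := fun p hp => ⟨ha.trans_le hp.1.1, hp.2.1⟩
      have hmK : MapsTo (fun p : ℝ × ℝ => (t - p.1, p.2)) (Icc a b ×ˢ Icc 0 R) {p | 0 < p.1} :=
        fun p hp => sub_pos.2 (hp.1.2.trans_lt hbt)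
      have k0 := (continuousOn_fullKer μ ν x).comp (f := fun p : ℝ × ℝ => (t - p.1, p.2))
        (by fun_prop) hmK
      have k1 := (continuousOn_fullKerDt μ ν x).comp (f := fun p : ℝ × ℝ => (t - p.1, p.2))
        (by fun_prop) hmK
      exact (((continuousOn_ut hu.1).mono hm).mul k0).sub ((hu.1.continuousOn.mono hm).mul k1)
  have ht : 0 < t := (ha.trans_le hab).trans hbt
  obtain ⟨huc, C, hC⟩ := hu.exists_bound ht
  have hint : ∀ s ∈ Icc a b, IntegrableOn (fun y => u s y * fullKer μ ν (t - s) x y) (Ioi 0) :=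
    fun s hs => integrableOn_mul_of_expDecayOn huc hC
      (expDecayOn_fullKer (b := t - a) μ ν x (sub_pos.2 hbt))
      ⟨ha.le.trans hs.1, hs.2.trans hbt.le⟩ ⟨by linarith [hs.2], by linarith [hs.1]⟩
      (continuous_fullKer μ ν x (sub_pos.2 (hs.2.trans_lt hbt)))
  have hb := hint b ⟨hab, le_rfl⟩
  have ha' := hint a ⟨le_rfl, hab⟩
  have hl := intervalIntegral_tendsto_integral_Ioi 0 (hb.sub ha') tendsto_id
  have hr := (tendsto_integral_flux_atTop hu x ha hab hbt).sub_const
    (u b 0 * Hker μ ν (t - b) x 0 - u a 0 * Hker μ ν (t - a) x 0)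
  have heq := tendsto_nhds_unique (hl.congr' (by
    filter_upwards [eventually_ge_atTop 0] with R hR using hrect R hR)) hr
  simp only [Pi.sub_apply] at heq
  rw [integral_sub hb ha'] at heq
  rw [pairing, pairing]
  linarith

theorem pairing_eq (hu : IsSWSolution μ ν f u) (x : ℝ) {t a b : ℝ} (ha : a ∈ Ioo 0 t)
    (hb : b ∈ Ioo 0 t) : pairing μ ν t x u a = pairing μ ν t x u b := by
  rcases le_total a b with h | h
  · exact pairing_eq_of_le hu x ha.1 h hb.2
  · exact (pairing_eq_of_le hu x hb.1 h ha.2).symm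

theorem tendsto_forward_apply {t y : ℝ} (ht : 0 < t)
    (huc : ContinuousOn (fun p : ℝ × ℝ => u p.1 p.2) (Icc 0 t ×ˢ Ici 0)) (hy : 0 ≤ y) :
    Tendsto (fun s => u s y) (nhdsWithin 0 (Ioi 0)) (nhds (u 0 y)) := by
  have h : ContinuousOn (fun s => u s y) (Icc 0 t) :=
    huc.comp (f := fun s => (s, y)) (by fun_prop) fun _ hs => ⟨hs, hy⟩
  exact (h 0 ⟨le_rfl, ht.le⟩).mono_left
    (nhdsWithin_le_iff.2 (mem_of_superset (Ioc_mem_nhdsGT ht) Ioc_subset_Icc_self))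

theorem tendsto_kernel_forward {t y : ℝ} (ht : 0 < t) {K : ℝ → ℝ → ℝ}
    (hK : ContinuousOn (fun p : ℝ × ℝ => K p.1 p.2) {p | 0 < p.1}) :
    Tendsto (fun s => K (t - s) y) (nhdsWithin 0 (Ioi 0)) (nhds (K t y)) := by
  have h : ContinuousAt (fun p : ℝ × ℝ => K p.1 p.2) (t - 0, y) :=
    hK.continuousAt ((isOpen_lt continuous_const continuous_fst).mem_nhds (by simpa using ht))
  have hc : ContinuousAt (fun s : ℝ => (t - s, y)) 0 := by fun_prop
  simpa [Function.comp_def] using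
    (ContinuousAt.comp (f := fun s : ℝ => (t - s, y)) h hc).tendsto.mono_left
      (nhdsWithin_le_nhds (s := Ioi 0))

theorem tendsto_pairing_zero (hu : IsSWSolution μ ν f u) (x : ℝ) {t : ℝ} (ht : 0 < t) :
    Tendsto (pairing μ ν t x u) (nhdsWithin 0 (Ioi 0)) (nhds (pairing μ ν t x u 0)) := by
  obtain ⟨huc, C, hC⟩ := hu.exists_bound ht
  have hmem : ∀ᶠ s in nhdsWithin (0 : ℝ) (Ioi 0), s ∈ Ioc 0 (t / 2) :=
    Ioc_mem_nhdsGT (half_pos ht)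
  refine Tendsto.add ?_ ?_
  · rw [sub_zero]
    refine tendsto_integral_mul_of_expDecayOn (σ := fun s => s) (τ := fun s => t - s)
      (F := fun r => fullKer μ ν r x) huc hC
      (expDecayOn_fullKer (b := t) μ ν x (half_pos ht))
      (fun r hr => continuous_fullKer μ ν x ((half_pos ht).trans_le hr.1)) ?_ ?_ fun y hy => ?_
    · filter_upwards [hmem] with s hs using ⟨hs.1.le, by linarith [hs.2]⟩
    · filter_upwards [hmem] with s hs using ⟨by linarith [hs.2], by linarith [hs.1]⟩
    · exact (tendsto_forward_apply ht huc hy.le).mul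
        (tendsto_kernel_forward (K := fun r => fullKer μ ν r x) ht (continuousOn_fullKer μ ν x))
  · rw [sub_zero]
    exact (tendsto_forward_apply ht huc le_rfl).mul
      (tendsto_kernel_forward (K := fun r => Hker μ ν r x) ht (continuousOn_Hker μ ν x))

theorem continuous_Hker (μ ν x : ℝ) {t : ℝ} (ht : 0 < t) : Continuous (Hker μ ν t x) :=
  continuous_iff_continuousAt.2 fun y => (hasDerivAt_Hker_y μ ν x y ht).continuousAt

theorem tendsto_integral_Hker (μ ν : ℝ) {t x C : ℝ} (ht : 0 < t) (hx : 0 ≤ x)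
    (huc : ContinuousOn (fun p : ℝ × ℝ => u p.1 p.2) (Icc 0 t ×ˢ Ici 0))
    (hC : ∀ s ∈ Icc 0 t, ∀ y ≥ (0 : ℝ), |u s y| ≤ C) :
    Tendsto (fun r => ∫ y in Ioi 0, u (t - r) y * Hker μ ν r x y) (nhdsWithin 0 (Ioi 0))
      (nhds 0) := by
  have h := tendsto_integral_mul_of_expDecayOn (σ := fun r => t - r) (τ := fun r => r)
    (F := fun r => Hker μ ν r x) (L := fun _ => 0) (l := nhdsWithin 0 (Ioi 0)) huc hC
    (expDecayOn_Hker μ ν x t) (fun r hr => continuous_Hker μ ν x hr.1)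
    (by filter_upwards [Ioc_mem_nhdsGT ht] with r hr
        exact ⟨by linarith [hr.2], by linarith [hr.1]⟩)
    (Ioc_mem_nhdsGT ht) fun y hy => by
      simpa using (tendsto_backward_apply ht huc hy.le tendsto_const_nhds
        (Eventually.of_forall fun _ => hy.le)).mul
          (tendsto_Hker_of_pos μ ν (add_pos_of_nonneg_of_pos hx hy))
  simpa using h

theorem pairing_backward (μ ν x t r : ℝ) :
    pairing μ ν t x u (t - r) = (∫ y in Ioi 0, u (t - r) y * fullKer μ ν r x y) +
      u (t - r) 0 * Hker μ ν r x 0 := by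
  rw [pairing, sub_sub_cancel]

theorem tendsto_boundary_zero (μ ν : ℝ) {t x c : ℝ} (ht : 0 < t)
    (huc : ContinuousOn (fun p : ℝ × ℝ => u p.1 p.2) (Icc 0 t ×ˢ Ici 0))
    (hc : Tendsto (fun r => Hker μ ν r x 0) (nhdsWithin 0 (Ioi 0)) (nhds c)) :
    Tendsto (fun r => u (t - r) 0 * Hker μ ν r x 0) (nhdsWithin 0 (Ioi 0))
      (nhds (u t 0 * c)) :=
  (tendsto_backward_apply ht huc le_rfl tendsto_const_nhds
    (Eventually.of_forall fun _ => le_rfl)).mul hc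

theorem tendsto_pairing_terminal (hu : IsSWSolution μ ν f u) {t x : ℝ} (ht : 0 < t)
    (hx : 0 ≤ x) :
    Tendsto (fun r => pairing μ ν t x u (t - r)) (nhdsWithin 0 (Ioi 0)) (nhds (u t x)) := by
  obtain ⟨huc, C, hC⟩ := hu.exists_bound ht
  have hH := (tendsto_integral_Hker μ ν ht hx huc hC).const_mul (2 * ν)
  simp only [pairing_backward]
  rcases hx.eq_or_lt with rfl | hx
  · have hb := hH.add (tendsto_boundary_zero μ ν ht huc (tendsto_Hker_zero μ ν))
    rw [mul_zero, zero_add, mul_one] at hb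
    refine hb.congr fun r => ?_
    rw [← integral_const_mul]
    congr 2
    ext y
    simp only [fullKer, reflKer]
    simp
    ring
  · have hb := tendsto_boundary_zero μ ν ht huc
      (tendsto_Hker_of_pos μ ν (x := x) (y := 0) (by simpa using hx))
    have hg := tendsto_integral_gaussKer μ ht hx.ne' huc hC
    have hr := (tendsto_integral_gaussKer μ ht (neg_ne_zero.2 hx.ne') huc hC).const_mul
      (Real.exp (-2 * μ * x))
    rw [if_pos hx] at hg
    rw [if_neg (by linarith)] at hr
    have hsum := ((hg.sub hr).add hH).add hb
    simp only [mul_zero, sub_zero, add_zero] at hsum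
    refine hsum.congr' ?_
    filter_upwards [Ioc_mem_nhdsGT ht] with r hr
    have hs : t - r ∈ Icc 0 t := ⟨by linarith [hr.2], by linarith [hr.1]⟩
    have ig : ∀ c, IntegrableOn (fun y => u (t - r) y * gaussKer μ c r y) (Ioi 0) := fun c =>
      integrableOn_mul_of_expDecayOn huc hC (expDecayOn_gaussKer (b := r) μ c hr.1) hs
        ⟨le_rfl, le_rfl⟩ (continuous_iff_continuousAt.2 fun y =>
          (hasDerivAt_gaussKer_y μ c y hr.1).continuousAt)
    have iH : IntegrableOn (fun y => u (t - r) y * Hker μ ν r x y) (Ioi 0) :=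
      integrableOn_mul_of_expDecayOn (F := fun r => Hker μ ν r x) huc hC
        (expDecayOn_Hker μ ν x t) hs hr (continuous_Hker μ ν x hr.1)
    rw [← integral_const_mul, ← integral_const_mul,
      ← integral_sub (ig x) ((ig (-x)).const_mul _),
      ← integral_add (by exact (ig x).sub ((ig (-x)).const_mul _)) (iH.const_mul _)]
    congr 2
    ext y
    simp only [fullKer, reflKer]
    ring

theorem IsSWSolution.eq_pairing_zero (hu : IsSWSolution μ ν f u) {t x : ℝ} (ht : 0 < t)
    (hx : 0 ≤ x) : u t x = pairing μ ν t x u 0 := by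
  have hmid : t / 2 ∈ Ioo 0 t := ⟨half_pos ht, half_lt_self ht⟩
  have h1 : Tendsto (pairing μ ν t x u) (nhdsWithin 0 (Ioi 0))
      (nhds (pairing μ ν t x u (t / 2))) := by
    refine tendsto_const_nhds.congr' ?_
    filter_upwards [Ioo_mem_nhdsGT ht] with s hs using pairing_eq hu x hmid hs
  have h2 : Tendsto (fun r => pairing μ ν t x u (t - r)) (nhdsWithin 0 (Ioi 0))
      (nhds (pairing μ ν t x u (t / 2))) := by
    refine tendsto_const_nhds.congr' ?_
    filter_upwards [Ioo_mem_nhdsGT ht] with r hr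
    exact pairing_eq hu x hmid ⟨by linarith [hr.2], by linarith [hr.1]⟩
  rw [tendsto_nhds_unique (tendsto_pairing_zero hu x ht) h1]
  exact tendsto_nhds_unique (tendsto_pairing_terminal hu ht hx) h2

end Solution

/-- integral representation of the solution valid without
smoothness of `f` in the integrand. -/
theorem stroock_williams_nonsmooth_representation (μ ν : ℝ) (f : ℝ → ℝ)
    (hf : IsInitialData f) (u : ℝ → ℝ → ℝ) (hu : IsSWSolution μ ν f u) :
    ∀ t > (0 : ℝ), ∀ x ≥ (0 : ℝ),
      u t x = (∫ y in Set.Ioi (0 : ℝ),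
          f y * (Gker μ t x y + deriv (fun z => Hker μ ν t x z) y)) +
        f 0 * Hker μ ν t x 0 := by
  intro t ht x hx
  have h0 := hu.2.2.2.2.1
  rw [hu.eq_pairing_zero ht hx, pairing, sub_zero, h0 0 le_rfl]
  congr 1
  refine setIntegral_congr_fun measurableSet_Ioi fun y hy => ?_
  simp only [Gker_add_deriv_Hker μ ν x y ht, h0 y (le_of_lt hy)]
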